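/- arXiv:quant-ph/0511065 — 2 statements merged into one kernel-verified Lean document; each statement's English description precedes it below -/
import Mathlib

section
/- Let R be a normed ring with ‖1‖ = 1, n ≥ 2 a natural number, ε ≥ 0, and U₀, E : Fin n → R with ‖U₀ i‖ ≤ 1 and ‖E i‖ ≤ ε for all i. For I ⊆ Fin n let F(I) be the ordered product f(n−1) · … · f(0) with f i = E i if i ∈ I and f i = U₀ i otherwise. Then the 'bad part' of the evolution, namely the ordered product of (U₀ i + E i) minus the sum of F(I) over all subsets I with |I| ≤ 1, has norm at most ∑_{k=2}^{n} C(n,k) ε^k, which in turn is at most C(n,2) · ε² · (1+ε)^{n−2}. -/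
open scoped BigOperators

theorem fault_path_expansion {R ι : Type*} [Ring R] [DecidableEq ι] (U E : ι → R)
    (l : List ι) (hl : l.Nodup) :
    (l.map (fun i => U i + E i)).prod
      = ∑ I ∈ l.toFinset.powerset, (l.map (fun i => if i ∈ I then E i else U i)).prod := by
  induction l with
  | nil => simp
  | cons a l ih =>
    rw [List.nodup_cons] at hl
    have ha : a ∉ l.toFinset := by simpa using hl.1
    rw [List.toFinset_cons, Finset.sum_powerset_insert ha, List.map_cons, List.prod_cons,
      ih hl.2, add_mul, Finset.mul_sum, Finset.mul_sum]
    congr 1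
    · refine Finset.sum_congr rfl fun I hI => ?_
      have haI : a ∉ I := fun h => ha (Finset.mem_powerset.mp hI h)
      simp [haI]
    · refine Finset.sum_congr rfl fun I hI => ?_
      rw [List.map_cons, List.prod_cons, if_pos (Finset.mem_insert_self a I)]
      congr 2
      refine List.map_congr_left fun i hi => ?_
      have hne : i ≠ a := fun h => hl.1 (h ▸ hi)
      simp [hne]

theorem fault_path_norm {R ι : Type*} [NormedRing R] [NormOneClass R] [DecidableEq ι]
    (U E : ι → R) (ε : ℝ) (hε : 0 ≤ ε) (hU : ∀ i, ‖U i‖ ≤ 1) (hE : ∀ i, ‖E i‖ ≤ ε)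
    (I : Finset ι) (l : List ι) :
    ‖(l.map (fun i => if i ∈ I then E i else U i)).prod‖
      ≤ (l.map (fun i => if i ∈ I then ε else 1)).prod := by
  induction l with
  | nil => simp
  | cons a l ih =>
    rw [List.map_cons, List.prod_cons, List.map_cons, List.prod_cons]
    refine (norm_mul_le _ _).trans ?_
    refine mul_le_mul ?_ ih (norm_nonneg _) ?_
    · split_ifs
      · exact hE a
      · exact hU a
    · split_ifs
      · exact hε
      · exact zero_le_one

/-- The 'bad part' of a noisy evolution of `n` locations, i.e. the full ordered product
of the `U₀ i + E i` minus the sum of all fault paths with at most one fault, has norm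
at most `∑_{k=2}^{n} C(n,k) ε^k`, which in turn is at most `C(n,2) ε² (1+ε)^{n-2}`. -/
theorem bad_part_norm_bound {R : Type*} [NormedRing R] [NormOneClass R]
    (n : ℕ) (hn : 2 ≤ n) (ε : ℝ) (hε : 0 ≤ ε) (U₀ E : Fin n → R)
    (hU : ∀ i, ‖U₀ i‖ ≤ 1) (hE : ∀ i, ‖E i‖ ≤ ε) :
    ‖(List.ofFn (fun i => U₀ i + E i)).reverse.prod
        - ∑ I ∈ Finset.univ.filter (fun I : Finset (Fin n) => I.card ≤ 1),
            (List.ofFn (fun i => if i ∈ I then E i else U₀ i)).reverse.prod‖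
      ≤ ∑ k ∈ Finset.Icc 2 n, (n.choose k : ℝ) * ε ^ k
    ∧ ∑ k ∈ Finset.Icc 2 n, (n.choose k : ℝ) * ε ^ k
        ≤ (n.choose 2 : ℝ) * ε ^ 2 * (1 + ε) ^ (n - 2) := by
  constructor
  · have key : ∀ f : Fin n → R, (List.ofFn f).reverse.prod
        = ((List.finRange n).reverse.map f).prod := by
      intro f
      rw [List.ofFn_eq_map, List.map_reverse]
    simp only [key]
    have hnd : (List.finRange n).reverse.Nodup := List.nodup_reverse.mpr (List.nodup_finRange n)
    have huniv : (List.finRange n).reverse.toFinset = Finset.univ := by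
      ext i; simp
    rw [fault_path_expansion U₀ E _ hnd, huniv, Finset.powerset_univ,
      ← Finset.sum_filter_add_sum_filter_not Finset.univ
        (fun I : Finset (Fin n) => I.card ≤ 1), add_sub_cancel_left]
    refine (norm_sum_le _ _).trans ?_
    have hb : ∀ I : Finset (Fin n),
        ‖((List.finRange n).reverse.map (fun i => if i ∈ I then E i else U₀ i)).prod‖
          ≤ ε ^ I.card := by
      intro I
      refine (fault_path_norm U₀ E ε hε hU hE I _).trans (le_of_eq ?_)
      rw [List.map_reverse, List.prod_reverse, ← List.ofFn_eq_map, List.prod_ofFn]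
      simp
    refine (Finset.sum_le_sum fun I _ => hb I).trans (le_of_eq ?_)
    rw [Finset.sum_filter, ← Finset.powerset_univ,
      Finset.sum_powerset_apply_card (fun m => if ¬ m ≤ 1 then ε ^ m else 0)]
    rw [Finset.card_univ, Fintype.card_fin]
    have hIcc : Finset.Icc 2 n = (Finset.range (n + 1)).filter (fun m => ¬ m ≤ 1) := by
      ext m; simp only [Finset.mem_Icc, Finset.mem_filter, Finset.mem_range]; omega
    rw [hIcc, Finset.sum_filter]
    refine Finset.sum_congr rfl fun m _ => ?_
    split_ifs <;> simp
  · obtain ⟨m, rfl⟩ : ∃ m, n = m + 2 := ⟨n - 2, by omega⟩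
    have hIcc : Finset.Icc 2 (m + 2) = (Finset.range (m + 1)).image (fun j => j + 2) := by
      ext k
      simp only [Finset.mem_Icc, Finset.mem_image, Finset.mem_range]
      exact ⟨fun h => ⟨k - 2, by omega, by omega⟩, fun ⟨j, h1, h2⟩ => by omega⟩
    rw [hIcc, Finset.sum_image (fun a _ b _ h => by simpa using h), Nat.add_sub_cancel,
      add_comm (1 : ℝ) ε, add_pow, Finset.mul_sum]
    refine Finset.sum_le_sum fun j hj => ?_
    have hj' : j ≤ m := by have := Finset.mem_range.mp hj; omega
    have h1 : (m + 2).choose (j + 2) ≤ (m + 2).choose 2 * m.choose j := by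
      have h := Nat.choose_mul (n := m + 2) (k := j + 2) (s := 2) (by omega)
      simp only [Nat.add_sub_cancel] at h
      rw [← h]
      exact Nat.le_mul_of_pos_right _ (Nat.choose_pos (by omega))
    have h2 : ((m + 2).choose (j + 2) : ℝ) ≤ (m + 2).choose 2 * m.choose j := by
      exact_mod_cast h1
    calc ((m + 2).choose (j + 2) : ℝ) * ε ^ (j + 2)
        ≤ ((m + 2).choose 2 * m.choose j) * ε ^ (j + 2) :=
          mul_le_mul_of_nonneg_right h2 (pow_nonneg hε _)
      _ = _ := by rw [one_pow]; ring
end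

section
/- For every natural number n ≥ 2 and every real ε with 0 ≤ ε ≤ 1/n, one has ∑_{k=2}^{n} C(n,k) ε^k ≤ e · C(n,2) · ε², where e = exp 1. -/
open scoped BigOperators

/-- For `n ≥ 2` and `0 ≤ ε ≤ 1/n`, the total amplitude of fault paths with at least two
faults, `∑_{k=2}^{n} C(n,k) ε^k`, is at most `e` times the leading term `C(n,2) ε²`.
This justifies the factor `e` in the threshold `ε_c = (e·A·α)⁻¹`. -/
theorem sum_choose_le_e_mul (n : ℕ) (hn : 2 ≤ n) (ε : ℝ) (hε0 : 0 ≤ ε)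
    (hε1 : ε ≤ 1 / n) :
    ∑ k ∈ Finset.Icc 2 n, (n.choose k : ℝ) * ε ^ k
      ≤ Real.exp 1 * (n.choose 2 : ℝ) * ε ^ 2 := by
  obtain ⟨m, rfl⟩ : ∃ m, n = m + 2 := ⟨n - 2, by omega⟩
  have hsum : ∑ k ∈ Finset.Icc 2 (m + 2), ((m + 2).choose k : ℝ) * ε ^ k
      = ∑ j ∈ Finset.range (m + 1), ((m + 2).choose (j + 2) : ℝ) * ε ^ (j + 2) := by
    symm
    apply Finset.sum_bij (fun j _ => j + 2)
    · intro a ha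
      simp only [Finset.mem_range, Finset.mem_Icc] at *
      omega
    · intro a _ b _ h
      omega
    · intro b hb
      simp only [Finset.mem_Icc] at hb
      exact ⟨b - 2, by simp only [Finset.mem_range]; omega, by omega⟩
    · intro a _
      rfl
  have hterm : ∀ j ∈ Finset.range (m + 1),
      ((m + 2).choose (j + 2) : ℝ) * ε ^ (j + 2)
        ≤ ((m + 2).choose 2 : ℝ) * ε ^ 2 * (ε ^ j * (m.choose j : ℝ)) := by
    intro j hj
    have hj' : j < m + 1 := Finset.mem_range.mp hj
    have h1 : (m + 2).choose (j + 2) * (j + 2).choose 2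
        = (m + 2).choose 2 * m.choose j := by
      have := Nat.choose_mul (n := m + 2) (k := j + 2) (s := 2) (by omega)
      simpa using this
    have h2 : 0 < (j + 2).choose 2 := Nat.choose_pos (by omega)
    have h3 : (m + 2).choose (j + 2) ≤ (m + 2).choose 2 * m.choose j := by
      rw [← h1]
      exact Nat.le_mul_of_pos_right _ h2
    have h4 : ((m + 2).choose (j + 2) : ℝ) ≤ ((m + 2).choose 2 : ℝ) * (m.choose j : ℝ) := by
      exact_mod_cast h3
    calc _ ≤ ((m + 2).choose 2 : ℝ) * (m.choose j : ℝ) * ε ^ (j + 2) :=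
          mul_le_mul_of_nonneg_right h4 (by positivity)
      _ = _ := by ring
  have hbin : ∑ j ∈ Finset.range (m + 1), ε ^ j * (m.choose j : ℝ) = (ε + 1) ^ m := by
    rw [add_pow]
    simp
  have hexp : (ε + 1) ^ m ≤ Real.exp 1 := by
    calc (ε + 1) ^ m ≤ (Real.exp ε) ^ m := by
          gcongr
          exact Real.add_one_le_exp ε
      _ = Real.exp (m * ε) := (Real.exp_nat_mul ε m).symm
      _ ≤ Real.exp 1 := by
          apply Real.exp_le_exp.mpr
          have hpos : (0 : ℝ) < ((m + 2 : ℕ) : ℝ) := by positivity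
          rw [le_div_iff₀ hpos] at hε1
          push_cast at hε1
          nlinarith
  rw [hsum]
  calc _ ≤ ∑ j ∈ Finset.range (m + 1),
        ((m + 2).choose 2 : ℝ) * ε ^ 2 * (ε ^ j * (m.choose j : ℝ)) :=
        Finset.sum_le_sum hterm
    _ = ((m + 2).choose 2 : ℝ) * ε ^ 2 * (ε + 1) ^ m := by
        rw [← Finset.mul_sum, hbin]
    _ ≤ ((m + 2).choose 2 : ℝ) * ε ^ 2 * Real.exp 1 :=
        mul_le_mul_of_nonneg_left hexp (by positivity)
    _ = _ := by ring
end
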